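/- Let (X, 𝒜, μ) be σ-finite and complete, u essentially bounded, T non-singular with h_T = 0 a.e. off Supp(u), and W_{u,T} bounded on L(p,q). For each k ≥ 0, ker(W_{u,T}^{k+1}) = ker(W_{u,T}^{k}) if and only if the measures μ_k = μ∘T⁻ᵏ and μ_{k+1} = μ∘T⁻⁽ᵏ⁺¹⁾ are mutually absolutely continuous. -/

import Mathlib

open MeasureTheory ENNReal Set

noncomputable section

/-- The distribution function `μ_f(s) = μ {x : |f x| > s}`. -/
def distrib {X : Type*} [MeasurableSpace X] (μ : Measure X) (f : X → ℂ) (s : ℝ) : ℝ≥0∞ :=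
  μ {x | s < ‖f x‖}

/-- The non-increasing rearrangement `f*(t) = inf {s > 0 : μ_f(s) ≤ t}` (with value `∞`
if no such `s` exists). -/
def rearr {X : Type*} [MeasurableSpace X] (μ : Measure X) (f : X → ℂ) (t : ℝ) : ℝ≥0∞ :=
  sInf (ENNReal.ofReal '' {s : ℝ | 0 < s ∧ distrib μ f s ≤ ENNReal.ofReal t})

/-- The average function `f**(t) = (1/t) ∫₀ᵗ f*(s) ds`. -/
def avgRearr {X : Type*} [MeasurableSpace X] (μ : Measure X) (f : X → ℂ) (t : ℝ) : ℝ≥0∞ :=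
  (ENNReal.ofReal t)⁻¹ * ∫⁻ s in Set.Ioc (0 : ℝ) t, rearr μ f s

/-- The Lorentz `L(p,q)` norm of `f`. -/
def lorentzNorm {X : Type*} [MeasurableSpace X] (μ : Measure X) (p q : ℝ≥0∞) (f : X → ℂ) :
    ℝ≥0∞ :=
  if q = ∞ then ⨆ t ∈ Set.Ioi (0 : ℝ), ENNReal.ofReal t ^ (1 / p.toReal) * avgRearr μ f t
  else (ENNReal.ofReal (q.toReal / p.toReal) *
      ∫⁻ t in Set.Ioi (0 : ℝ),
        (ENNReal.ofReal t ^ (1 / p.toReal) * avgRearr μ f t) ^ q.toReal *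
          (ENNReal.ofReal t)⁻¹) ^ (1 / q.toReal)

section IndicatorNorm

variable {X : Type*} [MeasurableSpace X] {μ : Measure X} {A : Set X}

lemma rearr_indicator_one_le (hA : μ A ≠ ∞) (t : ℝ) :
    rearr μ (A.indicator 1) t ≤ (Iio (μ A).toReal).indicator 1 t := by
  by_cases ht : t < (μ A).toReal
  · rw [indicator_of_mem (by exact ht)]
    refine sInf_le ⟨1, ⟨one_pos, ?_⟩, by simp⟩
    have : {x | (1 : ℝ) < ‖A.indicator (1 : X → ℂ) x‖} = ∅ := by
      ext x
      by_cases hx : x ∈ A <;> simp [hx]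
    simp [distrib, this]
  · rw [indicator_of_notMem (by exact ht)]
    refine ENNReal.le_of_forall_pos_le_add fun ε hε _ => ?_
    rw [zero_add]
    refine sInf_le ⟨ε, ⟨hε, ?_⟩, by simp⟩
    calc distrib μ (A.indicator 1) ε ≤ μ A := by
          refine measure_mono fun x hx => ?_
          by_contra hxA
          simp [hxA] at hx
      _ = ENNReal.ofReal (μ A).toReal := (ENNReal.ofReal_toReal hA).symm
      _ ≤ ENNReal.ofReal t := ENNReal.ofReal_le_ofReal (not_lt.1 ht)

lemma lintegral_rearr_indicator_one_le (hA : μ A ≠ ∞) (t : ℝ) :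
    ∫⁻ s in Ioc (0 : ℝ) t, rearr μ (A.indicator 1) s ≤ min (ENNReal.ofReal t) (μ A) := by
  calc ∫⁻ s in Ioc (0 : ℝ) t, rearr μ (A.indicator 1) s
      ≤ ∫⁻ s in Ioc (0 : ℝ) t, (Iio (μ A).toReal).indicator 1 s :=
        lintegral_mono fun s => rearr_indicator_one_le hA s
    _ = volume (Iio (μ A).toReal ∩ Ioc 0 t) := by
        rw [lintegral_indicator_one measurableSet_Iio, Measure.restrict_apply measurableSet_Iio]
    _ ≤ min (ENNReal.ofReal t) (μ A) := by
        refine le_min ((measure_mono inter_subset_right).trans (by simp)) ?_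
        calc volume (Iio (μ A).toReal ∩ Ioc 0 t) ≤ volume (Ioo 0 (μ A).toReal) :=
              measure_mono fun s hs => ⟨hs.2.1, hs.1⟩
          _ = μ A := by simp [hA]

lemma avgRearr_indicator_one_le_one (hA : μ A ≠ ∞) {t : ℝ} :
    avgRearr μ (A.indicator 1) t ≤ 1 := by
  calc avgRearr μ (A.indicator 1) t ≤ (ENNReal.ofReal t)⁻¹ * ENNReal.ofReal t := by
        unfold avgRearr
        gcongr
        exact (lintegral_rearr_indicator_one_le hA t).trans (min_le_left _ _)
    _ ≤ 1 := ENNReal.inv_mul_le_one _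

lemma avgRearr_indicator_one_le_measure (hA : μ A ≠ ∞) (t : ℝ) :
    avgRearr μ (A.indicator 1) t ≤ (ENNReal.ofReal t)⁻¹ * μ A := by
  unfold avgRearr
  gcongr
  exact (lintegral_rearr_indicator_one_le hA t).trans (min_le_right _ _)

lemma rpow_mul_avgRearr_indicator_one_le (hA : μ A ≠ ∞) {t : ℝ} (ht : 0 < t) (a : ℝ) :
    ENNReal.ofReal t ^ a * avgRearr μ (A.indicator 1) t ≤
      μ A * ENNReal.ofReal (t ^ (a - 1)) := by
  calc ENNReal.ofReal t ^ a * avgRearr μ (A.indicator 1) t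
      ≤ ENNReal.ofReal t ^ a * ((ENNReal.ofReal t)⁻¹ * μ A) := by
        gcongr
        exact avgRearr_indicator_one_le_measure hA t
    _ = μ A * ENNReal.ofReal (t ^ (a - 1)) := by
        rw [← ENNReal.ofReal_rpow_of_pos ht, ENNReal.rpow_sub _ _ (by simpa) (by simp),
          ENNReal.rpow_one, div_eq_mul_inv]
        ring

lemma lorentzNorm_indicator_one_lt_top (hA : μ A ≠ ∞) {p q : ℝ≥0∞} (hp : 1 < p) (hq : 1 ≤ q) :
    lorentzNorm μ p q (A.indicator 1) < ∞ := by
  have ha0 : 0 ≤ 1 / p.toReal := by positivity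
  have ha1 : 1 / p.toReal < 1 := by
    by_cases hp' : p = ∞
    · simp [hp']
    · have : 1 < p.toReal := by
        simpa using (ENNReal.toReal_lt_toReal ENNReal.one_ne_top hp').2 hp
      rw [div_lt_one (by linarith)]
      exact this
  unfold lorentzNorm
  split_ifs with hq'
  · refine lt_of_le_of_lt (iSup₂_le fun t ht => ?_) (max_lt ENNReal.one_lt_top hA.lt_top)
    have ht : 0 < t := ht
    rcases le_total t 1 with h1 | h1
    · refine le_max_of_le_left (mul_le_one' ?_ (avgRearr_indicator_one_le_one hA))
      exact ENNReal.rpow_le_one (by simpa using h1) ha0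
    · refine le_max_of_le_right ((rpow_mul_avgRearr_indicator_one_le hA ht _).trans ?_)
      refine mul_le_of_le_one_right' ?_
      rw [ENNReal.ofReal_le_one]
      exact Real.rpow_le_one_of_one_le_of_nonpos h1 (by linarith)
  have hq0 : 0 < q.toReal := ENNReal.toReal_pos (by positivity) hq'
  refine ENNReal.rpow_lt_top_of_nonneg (by positivity) ?_
  by_cases hp' : p = ∞
  · simp [hp']
  have hp0 : 0 < p.toReal := ENNReal.toReal_pos (by positivity) hp'
  have hapos : 0 < 1 / p.toReal := by positivity
  refine ENNReal.mul_ne_top ENNReal.ofReal_ne_top ?_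
  set a := 1 / p.toReal
  have rpow_mul_inv (b : ℝ) {t : ℝ} (ht : 0 < t) :
      ENNReal.ofReal (t ^ b) ^ q.toReal * (ENNReal.ofReal t)⁻¹ =
        ENNReal.ofReal (t ^ (b * q.toReal - 1)) := by
    rw [ENNReal.ofReal_rpow_of_pos (by positivity), ← Real.rpow_mul ht.le,
      ← ENNReal.ofReal_inv_of_pos ht, ← ENNReal.ofReal_mul (by positivity), Real.rpow_sub ht,
      Real.rpow_one, div_eq_mul_inv]
  rw [← Ioc_union_Ioi_eq_Ioi zero_le_one, lintegral_union measurableSet_Ioi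
    (Ioc_disjoint_Ioi le_rfl)]
  refine ENNReal.add_ne_top.2 ⟨?_, ?_⟩
  · have hint : IntegrableOn (fun t : ℝ => t ^ (a * q.toReal - 1)) (Ioc 0 1) :=
      (intervalIntegrable_iff_integrableOn_Ioc_of_le zero_le_one).1
        (intervalIntegral.intervalIntegrable_rpow' (by nlinarith))
    refine (lt_of_le_of_lt (setLIntegral_mono' measurableSet_Ioc fun t ht => ?_)
      hint.lintegral_lt_top).ne
    rw [← rpow_mul_inv a ht.1, ← ENNReal.ofReal_rpow_of_pos ht.1]
    gcongr
    exact mul_le_of_le_one_right' (avgRearr_indicator_one_le_one hA)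
  · have hint : IntegrableOn (fun t : ℝ => t ^ ((a - 1) * q.toReal - 1)) (Ioi 1) :=
      integrableOn_Ioi_rpow_of_lt (by nlinarith) one_pos
    refine (lt_of_le_of_lt (setLIntegral_mono' (g := fun t => μ A ^ q.toReal *
      ENNReal.ofReal (t ^ ((a - 1) * q.toReal - 1))) measurableSet_Ioi fun t ht => ?_) ?_).ne
    · have ht : 0 < t := one_pos.trans ht
      rw [← rpow_mul_inv (a - 1) ht, ← mul_assoc, ← ENNReal.mul_rpow_of_nonneg _ _ hq0.le]
      gcongr ?_ ^ _ * _
      exact rpow_mul_avgRearr_indicator_one_le hA ht a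
    · rw [lintegral_const_mul' _ _ (ENNReal.rpow_ne_top_of_nonneg hq0.le hA)]
      exact ENNReal.mul_lt_top (ENNReal.rpow_lt_top_of_nonneg hq0.le hA) hint.lintegral_lt_top

end IndicatorNorm

/-- If the density of `μ ∘ T⁻¹` vanishes off the support of `u`, then `u ∘ T ≠ 0` a.e. -/
lemma ae_comp_ne_zero_of_rnDeriv_eq_zero {X : Type*} [MeasurableSpace X] {μ : Measure X}
    [SigmaFinite μ] {T : X → X} (hT : Measure.QuasiMeasurePreserving T μ μ)
    {u : X → ℂ} (hu : Measurable u)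
    (hsupp : ∀ᵐ x ∂μ, u x = 0 → (μ.map T).rnDeriv μ x = 0) :
    ∀ᵐ x ∂μ, u (T x) ≠ 0 := by
  have hm : MeasurableSet {x | u x = 0} := hu (measurableSet_singleton 0)
  have h : μ.map T {x | u x = 0} = 0 := by
    rw [← Measure.withDensity_rnDeriv_eq (μ.map T) μ hT.absolutelyContinuous,
      withDensity_apply _ hm, setLIntegral_congr_fun_ae hm hsupp, lintegral_zero]
  rw [Measure.map_apply hT.measurable hm] at h
  rw [ae_iff]
  simpa using h

/-- The iterated weighted composition vanishes a.e. iff `f` vanishes `μ ∘ T⁻ⁿ`-a.e. -/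
lemma weighted_iterate_ae_eq_zero_iff {X : Type*} [MeasurableSpace X] {μ : Measure X}
    {T : X → X} (hT : Measure.QuasiMeasurePreserving T μ μ) {u : X → ℂ}
    (hne : ∀ᵐ x ∂μ, u (T x) ≠ 0) {f : X → ℂ} (hf : Measurable f) (n : ℕ) :
    (fun x => (∏ i ∈ Finset.Icc 1 n, u (T^[i] x)) * f (T^[n] x)) =ᵐ[μ] 0 ↔
      μ.map T^[n] {x | f x ≠ 0} = 0 := by
  have hprod : ∀ᵐ x ∂μ, ∏ i ∈ Finset.Icc 1 n, u (T^[i] x) ≠ 0 := by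
    have hall : ∀ᵐ x ∂μ, ∀ i : ℕ, u (T^[i + 1] x) ≠ 0 := by
      refine ae_all_iff.2 fun i => ?_
      simp only [Function.iterate_succ_apply']
      exact (hT.iterate i).ae hne
    filter_upwards [hall] with x hx
    refine Finset.prod_ne_zero_iff.2 fun i hi => ?_
    obtain ⟨j, rfl⟩ := Nat.exists_eq_add_of_le' (Finset.mem_Icc.1 hi).1
    exact hx j
  have hm : MeasurableSet {x | f x ≠ 0} := hf (measurableSet_singleton 0).compl
  rw [Measure.map_apply (hT.measurable.iterate n) hm]
  change _ ↔ ∀ᵐ x ∂μ, f (T^[n] x) = 0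
  refine Filter.eventually_congr ?_
  filter_upwards [hprod] with x hx
  simp [hx]

/-- Absolute continuity may be tested on sets of finite measure for a `σ`-finite measure. -/
lemma absolutelyContinuous_of_forall_measure_ne_top {X : Type*} [MeasurableSpace X]
    (μ : Measure X) [SigmaFinite μ] {ν ρ : Measure X}
    (h : ∀ A, MeasurableSet A → μ A ≠ ∞ → ρ A = 0 → ν A = 0) : ν ≪ ρ := by
  refine Measure.AbsolutelyContinuous.mk fun A hA hρ => ?_
  rw [← inter_univ A, ← iUnion_spanningSets μ, inter_iUnion, measure_iUnion_null_iff]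
  intro n
  exact h _ (hA.inter (measurableSet_spanningSets μ n))
    ((measure_mono inter_subset_right).trans_lt (measure_spanningSets_lt_top μ n)).ne
    (measure_mono_null inter_subset_left hρ)

/-- For a bounded weighted composition operator `W_{u,T}` on `L(p,q)` with `u` essentially
bounded and `h_T = 0` a.e. off the support of `u`: the kernels of `W^{k+1}` and `W^k`
coincide iff the measures `μ_k = μ∘T⁻ᵏ` and `μ_{k+1}` are mutually absolutely continuous. -/
theorem ker_eq_iff_measures_equiv {X : Type*} [MeasurableSpace X] (μ : Measure X)
    [SigmaFinite μ] (hc : μ.IsComplete) (T : X → X) (hT : Measurable T)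
    (hns : ∀ A : Set X, MeasurableSet A → μ A = 0 → μ (T ⁻¹' A) = 0)
    (u : X → ℂ) (hu : Measurable u) (hbdd : ∃ C : ℝ, ∀ᵐ x ∂μ, ‖u x‖ ≤ C)
    (hsupp : ∀ᵐ x ∂μ, u x = 0 → (μ.map T).rnDeriv μ x = 0)
    (p q : ℝ≥0∞) (hp : 1 < p) (hq : 1 ≤ q)
    (hWbdd : ∃ C : ℝ≥0∞, ∀ f : X → ℂ, Measurable f →
      lorentzNorm μ p q (fun x => u (T x) * f (T x)) ≤ C * lorentzNorm μ p q f)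
    (k : ℕ) :
    (∀ f : X → ℂ, Measurable f → lorentzNorm μ p q f < ∞ →
        ((fun x => (∏ i ∈ Finset.Icc 1 (k + 1), u (T^[i] x)) * f (T^[k + 1] x)) =ᵐ[μ] 0 ↔
          (fun x => (∏ i ∈ Finset.Icc 1 k, u (T^[i] x)) * f (T^[k] x)) =ᵐ[μ] 0)) ↔
      (μ.map (T^[k]) ≪ μ.map (T^[k + 1]) ∧ μ.map (T^[k + 1]) ≪ μ.map (T^[k])) := by
  have hTq : Measure.QuasiMeasurePreserving T μ μ :=
    ⟨hT, Measure.AbsolutelyContinuous.mk fun A hA h => by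
      rw [Measure.map_apply hT hA]
      exact hns A hA h⟩
  have hne := ae_comp_ne_zero_of_rnDeriv_eq_zero hTq hu hsupp
  constructor
  · intro h
    have key (A : Set X) (hA : MeasurableSet A) (hfin : μ A ≠ ∞) :
        μ.map T^[k + 1] A = 0 ↔ μ.map T^[k] A = 0 := by
      have hf : Measurable (A.indicator (1 : X → ℂ)) := measurable_one.indicator hA
      have hset : {x | A.indicator (1 : X → ℂ) x ≠ 0} = A := by
        ext x
        simp
      have := h _ hf (lorentzNorm_indicator_one_lt_top hfin hp hq)
      rwa [weighted_iterate_ae_eq_zero_iff hTq hne hf, weighted_iterate_ae_eq_zero_iff hTq hne hf,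
        hset] at this
    exact ⟨absolutelyContinuous_of_forall_measure_ne_top μ fun A hA hfin => (key A hA hfin).1,
      absolutelyContinuous_of_forall_measure_ne_top μ fun A hA hfin => (key A hA hfin).2⟩
  · rintro ⟨h₁, h₂⟩ f hf -
    rw [weighted_iterate_ae_eq_zero_iff hTq hne hf, weighted_iterate_ae_eq_zero_iff hTq hne hf]
    exact ⟨fun h => h₁ h, fun h => h₂ h⟩
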